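/- Let W = m_1P_1+⋯+m_sP_s be a fat point scheme in P^n over a field K of characteristic zero, and let Y = (m_1−1)P_1+⋯+(m_s−1)P_s be its slimming. Then the Hilbert polynomial of the module of Kähler differential (n+1)-forms Ω^{n+1}_{R_W/K} is the constant polynomial Σ_{j=1}^s C(m_j+n−2, n), i.e., it equals the multiplicity (degree) of Y. -/

import Mathlib

open MvPolynomial

/-- The homogeneous vanishing ideal of the `K`-rational point of `ℙ^n` with homogeneous
coordinates `v`. -/
noncomputable def pointIdeal {K : Type*} [Field K] {n : ℕ} (v : Fin (n + 1) → K) :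
    Ideal (MvPolynomial (Fin (n + 1)) K) :=
  Ideal.span {F | (∃ d, F.IsHomogeneous d) ∧ MvPolynomial.eval v F = 0}

/-- The ideal `∂I` generated by all partial derivatives of elements of `I`. -/
noncomputable def partialsIdeal {K : Type*} [Field K] {n : ℕ}
    (I : Ideal (MvPolynomial (Fin (n + 1)) K)) : Ideal (MvPolynomial (Fin (n + 1)) K) :=
  Ideal.span {g | ∃ F ∈ I, ∃ j : Fin (n + 1), g = pderiv j F}

/-- The dimension of the degree-`i` homogeneous component of `S/I`. -/
noncomputable def quotHF {K : Type*} [Field K] {n : ℕ}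
    (I : Ideal (MvPolynomial (Fin (n + 1)) K)) (i : ℕ) : ℕ :=
  Module.finrank K
    (↥(homogeneousSubmodule (Fin (n + 1)) K i) ⧸
      Submodule.comap (homogeneousSubmodule (Fin (n + 1)) K i).subtype
        (I.restrictScalars K))

namespace MvPolynomial

variable {σ R : Type*} [CommSemiring R]

theorem add_le_degree_of_mem_span_X_image_compl_pow {c : σ} {k : ℕ} {p : MvPolynomial σ R}
    (hp : p ∈ Ideal.span (X '' {c}ᶜ : Set (MvPolynomial σ R)) ^ k) :
    ∀ x ∈ p.support, k + x c ≤ x.degree := by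
  classical
  induction k generalizing p with
  | zero => intro x _; simpa using Finsupp.le_degree c x
  | succ k ih =>
    rw [pow_succ] at hp
    induction hp using Submodule.mul_induction_on' with
    | mem_mul_mem a ha b hb =>
      intro x hx
      obtain ⟨y, hy, z, hz, rfl⟩ := Finset.mem_add.mp (support_mul _ _ hx)
      have h1 := ih ha y hy
      obtain ⟨i, hi, hzi⟩ := mem_ideal_span_X_image.mp hb z hz
      have h2 : Finsupp.single c (z c) + Finsupp.single i 1 ≤ z := by
        intro j
        have hic : i ≠ c := hi
        simp only [Finsupp.add_apply, Finsupp.single_apply]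
        split_ifs with h3 h4 h4 <;> grind
      have h3 := Finsupp.degree_mono h2
      simp only [map_add, Finsupp.degree_single, Finsupp.add_apply] at h3 ⊢
      omega
    | add a _ b _ ha hb =>
      intro x hx
      rcases Finset.mem_union.mp (support_add hx) with h | h
      · exact ha x h
      · exact hb x h

theorem mem_span_X_image_compl_pow_of_add_le_degree {c : σ} {k : ℕ} {p : MvPolynomial σ R}
    (hp : ∀ x ∈ p.support, k + x c ≤ x.degree) :
    p ∈ Ideal.span (X '' {c}ᶜ : Set (MvPolynomial σ R)) ^ k := by
  classical
  rw [p.as_sum]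
  refine Ideal.sum_mem _ fun x hx ↦ ?_
  rw [monomial_eq, ← Finsupp.mul_prod_erase' x c (fun i e ↦ (X i : MvPolynomial σ R) ^ e) (by simp)]
  refine Ideal.mul_mem_left _ _ (Ideal.mul_mem_left _ _ ?_)
  have hdeg : k ≤ (x.erase c).degree := by
    have h1 := congrArg Finsupp.degree (Finsupp.single_add_erase c x)
    have h2 := hp x hx
    rw [map_add, Finsupp.degree_single] at h1
    omega
  refine Ideal.pow_le_pow_right hdeg ?_
  rw [Finsupp.prod, Finsupp.degree_apply, ← Finset.prod_pow_eq_pow_sum]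
  refine Ideal.prod_mem_prod fun i hi ↦ ?_
  refine Ideal.pow_mem_pow (Ideal.subset_span (Set.mem_image_of_mem X ?_)) _
  rintro rfl
  simp at hi

theorem mem_span_X_image_compl_pow_iff {c : σ} {k : ℕ} {p : MvPolynomial σ R} :
    p ∈ Ideal.span (X '' {c}ᶜ : Set (MvPolynomial σ R)) ^ k ↔
      ∀ x ∈ p.support, k + x c ≤ x.degree :=
  ⟨add_le_degree_of_mem_span_X_image_compl_pow, mem_span_X_image_compl_pow_of_add_le_degree⟩

end MvPolynomial

section HilbertFunction

variable {K : Type*} [Field K] {n : ℕ}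

theorem quotHF_span_X_image_compl_pow (c : Fin (n + 1)) {k i : ℕ} (hi : k ≤ i) :
    quotHF (Ideal.span (X '' {c}ᶜ : Set (MvPolynomial (Fin (n + 1)) K)) ^ (k + 1)) i =
      (k + n).choose n := by
  classical
  let T := (Finset.univ : Finset (Fin (n + 1))).finsuppAntidiag k
  have hT (d : Fin (n + 1) →₀ ℕ) : d ∈ T ↔ d.degree = k := by
    simp [T, Finset.mem_finsuppAntidiag, Finsupp.degree_eq_sum]
  let Φ : ↥(homogeneousSubmodule (Fin (n + 1)) K i) →ₗ[K] (T → K) :=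
    (LinearMap.pi fun d : T ↦ lcoeff K (d.1 + Finsupp.single c (i - k))) ∘ₗ Submodule.subtype _
  have hΦ (F : ↥(homogeneousSubmodule (Fin (n + 1)) K i)) (d : T) :
      Φ F d = coeff (d.1 + Finsupp.single c (i - k)) F.1 := rfl
  have hdeg (d : T) : (d.1 + Finsupp.single c (i - k)).degree = i := by
    rw [map_add, Finsupp.degree_single, (hT _).mp d.2]; omega
  have hsurj : Function.Surjective Φ := by
    intro g
    refine ⟨⟨∑ d : T, monomial (d.1 + Finsupp.single c (i - k)) (g d), ?_⟩, ?_⟩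
    · exact Submodule.sum_mem _ fun d _ ↦ isHomogeneous_monomial _ (hdeg d)
    · ext d
      rw [hΦ, coeff_sum, Finset.sum_eq_single d]
      · simp
      · intro e _ hed
        rw [coeff_monomial, if_neg]
        exact fun h ↦ hed (Subtype.ext (add_right_cancel h))
      · simp
  have hker : Φ.ker = Submodule.comap (homogeneousSubmodule (Fin (n + 1)) K i).subtype
      ((Ideal.span (X '' {c}ᶜ : Set (MvPolynomial (Fin (n + 1)) K)) ^ (k + 1)).restrictScalars
        K) := by
    ext F
    rw [LinearMap.mem_ker, Submodule.mem_comap, Submodule.restrictScalars_mem,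
      mem_span_X_image_compl_pow_iff]
    constructor
    · intro h x hx
      have hxi : x.degree = i := by
        by_contra hne
        exact mem_support_iff.mp hx (F.2.coeff_eq_zero hne)
      by_contra hlt
      have hsplit : x - Finsupp.single c (i - k) + Finsupp.single c (i - k) = x := by
        refine tsub_add_cancel_of_le ?_
        rw [Finsupp.single_le_iff]
        omega
      have hd : x - Finsupp.single c (i - k) ∈ T := by
        have := congrArg Finsupp.degree hsplit
        rw [map_add, Finsupp.degree_single] at this
        rw [hT]; omega
      refine mem_support_iff.mp hx ?_
      have := congrFun h ⟨_, hd⟩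
      rw [hΦ, hsplit] at this
      exact this
    · intro h
      ext d
      rw [hΦ, Pi.zero_apply]
      by_contra hne
      have := h _ (mem_support_iff.mpr hne)
      rw [hdeg] at this
      simp only [Finsupp.add_apply, Finsupp.single_eq_same] at this
      omega
  rw [quotHF, ← hker, (Φ.quotKerEquivOfSurjective hsurj).finrank_eq,
    Module.finrank_fintype_fun_eq_card, Fintype.card_coe,
    Finset.card_finsuppAntidiag_nat_eq_choose, Finset.card_univ, Fintype.card_fin,
    show n + 1 + k - 1 = k + n by omega, Nat.choose_symm_add]

/-- Linear changes of coordinates do not change Hilbert functions. -/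
theorem quotHF_comap_algEquiv
    (e : MvPolynomial (Fin (n + 1)) K ≃ₐ[K] MvPolynomial (Fin (n + 1)) K)
    (he : ∀ j, (e (X j)).IsHomogeneous 1) (he' : ∀ j, (e.symm (X j)).IsHomogeneous 1)
    (I : Ideal (MvPolynomial (Fin (n + 1)) K)) (i : ℕ) :
    quotHF (I.comap e) i = quotHF I i := by
  have key (f : MvPolynomial (Fin (n + 1)) K ≃ₐ[K] MvPolynomial (Fin (n + 1)) K)
      (hf : ∀ j, (f (X j)).IsHomogeneous 1) (F : MvPolynomial (Fin (n + 1)) K)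
      (hF : F.IsHomogeneous i) : (f F).IsHomogeneous i := by
    have := hF.aeval (fun j ↦ f (X j)) hf
    rw [one_mul] at this
    convert this
    exact DFunLike.congr_fun (aeval_unique f.toAlgHom) F
  have hmap : Submodule.map (e.toLinearEquiv : _ →ₗ[K] _) (homogeneousSubmodule (Fin (n + 1)) K i) =
      homogeneousSubmodule (Fin (n + 1)) K i := by
    ext F
    constructor
    · rintro ⟨G, hG, rfl⟩
      exact key e he G hG
    · exact fun hF ↦ ⟨e.symm F, key e.symm he' F hF, by simp⟩
  refine (Submodule.Quotient.equiv _ _ (e.toLinearEquiv.ofSubmodules _ _ hmap) ?_).finrank_eq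
  ext F
  rw [Submodule.mem_map_equiv]
  simp [LinearEquiv.ofSubmodules_symm_apply]

instance homogeneousSubmodule_finite (i : ℕ) :
    Module.Finite K ↥(homogeneousSubmodule (Fin (n + 1)) K i) :=
  Module.Finite.iff_fg.mpr (homogeneousSubmodule_fg _ _ _)

theorem finrank_quotient_eq_sum {V ι : Type*} [AddCommGroup V] [Module K V] [Module.Finite K V]
    [Fintype ι] [DecidableEq ι] (p : Submodule K V) (q : ι → Submodule K V)
    (hp : ∀ x, x ∈ p ↔ ∀ j, x ∈ q j)
    (hlift : ∀ j x, ∃ y, x - y ∈ q j ∧ ∀ k ≠ j, y ∈ q k) :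
    Module.finrank K (V ⧸ p) = ∑ j, Module.finrank K (V ⧸ q j) := by
  let Φ : V →ₗ[K] (∀ j, V ⧸ q j) := LinearMap.pi fun j ↦ (q j).mkQ
  have hker : Φ.ker = p := by
    ext F
    simp only [Φ, LinearMap.mem_ker, funext_iff, LinearMap.pi_apply, Submodule.mkQ_apply,
      Pi.zero_apply, Submodule.Quotient.mk_eq_zero, hp]
  have hsurj : Function.Surjective Φ := by
    intro g
    choose f hf using fun j ↦ (q j).mkQ_surjective (g j)
    choose G hG1 hG2 using fun j ↦ hlift j (f j)
    refine ⟨∑ j, G j, ?_⟩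
    ext j
    rw [LinearMap.pi_apply, ← hf j, ← sub_eq_zero, ← map_sub, Submodule.mkQ_apply,
      Submodule.Quotient.mk_eq_zero, ← Finset.add_sum_erase _ _ (Finset.mem_univ j),
      add_sub_right_comm]
    refine Submodule.add_mem _ ?_
      (Submodule.sum_mem _ fun k hk ↦ hG2 k j (Finset.ne_of_mem_erase hk).symm)
    rw [← neg_sub]
    exact Submodule.neg_mem _ (hG1 j)
  rw [← hker, (Φ.quotKerEquivOfSurjective hsurj).finrank_eq, Module.finrank_pi_fintype]

theorem quotHF_eq_sum {s : ℕ} (Q : Fin s → Ideal (MvPolynomial (Fin (n + 1)) K))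
    (J : Ideal (MvPolynomial (Fin (n + 1)) K)) (i : ℕ)
    (hQ : ∀ j, ∀ F ∈ Q j, homogeneousComponent i F ∈ Q j)
    (hJ : ∀ F : MvPolynomial (Fin (n + 1)) K, F.IsHomogeneous i → (F ∈ J ↔ ∀ j, F ∈ Q j))
    (hcop : ∀ F : MvPolynomial (Fin (n + 1)) K, F.IsHomogeneous i →
      ∀ j, F ∈ Q j ⊔ ⨅ k : {k // k ≠ j}, Q k) :
    quotHF J i = ∑ j, quotHF (Q j) i := by
  unfold quotHF
  refine finrank_quotient_eq_sum _ _ (fun F ↦ hJ F.1 F.2) fun j F ↦ ?_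
  obtain ⟨a, ha, b, hb, hab⟩ := Submodule.mem_sup.mp (hcop F.1 F.2 j)
  refine ⟨⟨homogeneousComponent i b, homogeneousComponent_mem _ _⟩, ?_, ?_⟩
  · change F.1 - homogeneousComponent i b ∈ Q j
    have : F.1 - homogeneousComponent i b = homogeneousComponent i a := by
      rw [sub_eq_iff_eq_add, ← map_add, hab, homogeneousComponent_eq_self F.2]
    rw [this]
    exact hQ j a ha
  · intro k hk
    exact hQ k b (Ideal.mem_iInf.mp hb ⟨k, hk⟩)

end HilbertFunction

section PointIdeal

variable {K : Type*} [Field K] {n : ℕ}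

/-- The linear forms `v_c X_k - v_k X_c` vanishing at `v`. -/
noncomputable def pointForm (v : Fin (n + 1) → K) (c k : Fin (n + 1)) :
    MvPolynomial (Fin (n + 1)) K :=
  C (v c) * X k - C (v k) * X c

theorem pointForm_self (v : Fin (n + 1) → K) (c : Fin (n + 1)) : pointForm v c c = 0 :=
  sub_self _

theorem pointForm_mem (v : Fin (n + 1) → K) (c k : Fin (n + 1)) :
    pointForm v c k ∈ pointIdeal v := by
  refine Ideal.subset_span ⟨⟨1, ?_⟩, ?_⟩
  · exact (isHomogeneous_C_mul_X _ _).sub (isHomogeneous_C_mul_X _ _)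
  · simp [pointForm, mul_comm]

theorem MvPolynomial.IsHomogeneous.aeval_mul_left {R A σ : Type*} [CommSemiring R] [CommSemiring A]
    [Algebra R A] [Fintype σ] {F : MvPolynomial σ R} {d : ℕ} (hF : F.IsHomogeneous d) (r : A)
    (g : σ → A) : MvPolynomial.aeval (fun k ↦ r * g k) F = r ^ d * MvPolynomial.aeval g F := by
  rw [aeval_def, eval₂_eq', aeval_def, eval₂_eq', Finset.mul_sum]
  refine Finset.sum_congr rfl fun x hx ↦ ?_
  have hx : ∑ i, x i = d := by
    rw [← Finsupp.degree_eq_sum]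
    by_contra hne
    exact mem_support_iff.mp hx (hF.coeff_eq_zero hne)
  simp_rw [mul_pow, Finset.prod_mul_distrib, Finset.prod_pow_eq_pow_sum, hx]
  ring

theorem pointIdeal_eq_span {v : Fin (n + 1) → K} {c : Fin (n + 1)} (hc : v c ≠ 0) :
    pointIdeal v = Ideal.span (Set.range (pointForm v c)) := by
  apply le_antisymm
  · refine Ideal.span_le.mpr ?_
    rintro F ⟨⟨d, hF⟩, hF0⟩
    set I := Ideal.span (Set.range (pointForm v c))
    have h1 : aeval (fun k ↦ (C (v c) * X k : MvPolynomial (Fin (n + 1)) K)) F =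
        C (v c) ^ d * F := by
      rw [hF.aeval_mul_left, aeval_X_left_apply]
    have h2 : aeval (fun k ↦ (X c * C (v k) : MvPolynomial (Fin (n + 1)) K)) F = 0 := by
      rw [hF.aeval_mul_left]
      have : aeval (fun k ↦ (C (v k) : MvPolynomial (Fin (n + 1)) K)) F = C (eval v F) := by
        rw [← algebraMap_eq, ← coe_aeval_eq_eval]
        exact aeval_algebraMap_apply _ v F
      rw [this, hF0, C_0, mul_zero]
    have h3 : Ideal.Quotient.mkₐ K I (aeval (fun k ↦ C (v c) * X k) F) =
        Ideal.Quotient.mkₐ K I (aeval (fun k ↦ X c * C (v k)) F) := by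
      rw [← AlgHom.comp_apply, ← AlgHom.comp_apply]
      congr 1
      ext k
      simp only [AlgHom.comp_apply, aeval_X, Ideal.Quotient.mkₐ_eq_mk]
      rw [Ideal.Quotient.eq, mul_comm (X c)]
      exact Ideal.subset_span ⟨k, rfl⟩
    rw [h1, h2, map_zero, Ideal.Quotient.mkₐ_eq_mk, Ideal.Quotient.eq_zero_iff_mem] at h3
    have h4 := I.mul_mem_left (C (v c)⁻¹ ^ d) h3
    rwa [← mul_assoc, ← mul_pow, ← C_mul, inv_mul_cancel₀ hc, C_1, one_pow, one_mul] at h4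
  · refine Ideal.span_le.mpr ?_
    rintro _ ⟨k, rfl⟩
    exact pointForm_mem v c k

theorem idealOfVars_le_sup_pointIdeal {v w : Fin (n + 1) → K} (hv : v ≠ 0)
    (hvw : ∀ a : K, w ≠ a • v) :
    idealOfVars (Fin (n + 1)) K ≤ pointIdeal v ⊔ pointIdeal w := by
  obtain ⟨c, hc⟩ := Function.ne_iff.mp hv
  simp only [Pi.zero_apply] at hc
  set Q := pointIdeal v ⊔ pointIdeal w
  have hyv (a b) : pointForm v a b ∈ Q := le_sup_left (a := pointIdeal v) (pointForm_mem v a b)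
  have hyw (a b) : pointForm w a b ∈ Q := le_sup_right (a := pointIdeal v) (pointForm_mem w a b)
  have hunit {a : K} (ha : a ≠ 0) {F : MvPolynomial (Fin (n + 1)) K} (h : C a * F ∈ Q) : F ∈ Q := by
    have := Q.mul_mem_left (C a⁻¹) h
    rwa [← mul_assoc, ← C_mul, inv_mul_cancel₀ ha, C_1, one_mul] at this
  obtain ⟨b, hb⟩ := Function.ne_iff.mp (hvw (w c / v c))
  have hb' : w c * v b - w b * v c ≠ 0 := by
    intro h
    apply hb
    rw [Pi.smul_apply, smul_eq_mul]
    field_simp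
    linear_combination -h
  have hX : X c ∈ Q := by
    refine hunit hb' ?_
    have := Q.sub_mem (Q.mul_mem_left (C (v c)) (hyw c b)) (Q.mul_mem_left (C (w c)) (hyv c b))
    convert this using 1
    simp only [pointForm, C_sub, C_mul]
    ring
  refine Ideal.span_le.mpr ?_
  rintro _ ⟨k, rfl⟩
  refine hunit hc ?_
  have := Q.add_mem (hyv c k) (Q.mul_mem_left (C (v k)) hX)
  rwa [pointForm, sub_add_cancel] at this

theorem homogeneousComponent_mem_pointIdeal_pow {v : Fin (n + 1) → K} {k : ℕ}
    {F : MvPolynomial (Fin (n + 1)) K} (hF : F ∈ (pointIdeal v) ^ k) (i : ℕ) :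
    homogeneousComponent i F ∈ (pointIdeal v) ^ k := by
  let _ : GradedAlgebra (homogeneousSubmodule (Fin (n + 1)) K) := MvPolynomial.gradedAlgebra
  have h (k : ℕ) : ((pointIdeal v) ^ k).IsHomogeneous (homogeneousSubmodule (Fin (n + 1)) K) := by
    induction k with
    | zero => rw [pow_zero, Ideal.one_eq_top]; exact Ideal.IsHomogeneous.top _
    | succ k ih =>
      rw [pow_succ]
      exact ih.mul (Ideal.homogeneous_span _ _ fun F hF ↦ hF.1)
  exact homogeneousComponent_mem_of_mem (h k) hF i

theorem quotHF_pointIdeal_pow {v : Fin (n + 1) → K} (hv : v ≠ 0) {k i : ℕ} (hi : k ≤ i) :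
    quotHF ((pointIdeal v) ^ (k + 1)) i = (k + n).choose n := by
  classical
  obtain ⟨c, hc⟩ := Function.ne_iff.mp hv
  simp only [Pi.zero_apply] at hc
  let e : MvPolynomial (Fin (n + 1)) K ≃ₐ[K] MvPolynomial (Fin (n + 1)) K :=
    AlgEquiv.ofAlgHom
      (aeval fun k ↦ if k = c then X c else X k + C (v k / v c) * X c)
      (aeval fun k ↦ if k = c then X c else X k - C (v k / v c) * X c)
      (by
        ext1 k
        by_cases hk : k = c
        · simp [hk]
        · simp [hk, algHom_C])
      (by
        ext1 k
        by_cases hk : k = c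
        · simp [hk]
        · simp [hk, algHom_C])
  have heX (k) : e (X k) = if k = c then X c else X k + C (v k / v c) * X c := by
    simp [e]
  have heX' (k) : e.symm (X k) = if k = c then X c else X k - C (v k / v c) * X c := by
    simp [e]
  have heC (a : K) : e (C a) = C a := e.commutes a
  have hform (k) : e (pointForm v c k) = if k = c then 0 else C (v c) * X k := by
    rw [pointForm, map_sub, map_mul, map_mul, heC, heC, heX, heX, if_pos rfl]
    split_ifs with hk
    · simp [hk]
    · rw [mul_add, ← mul_assoc, ← C_mul, mul_div_cancel₀ _ hc, add_sub_cancel_right]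
  have hmap : (pointIdeal v).map e = Ideal.span (X '' {c}ᶜ) := by
    rw [pointIdeal_eq_span hc, Ideal.map_span]
    apply le_antisymm <;> refine Ideal.span_le.mpr ?_
    · rintro _ ⟨_, ⟨k, rfl⟩, rfl⟩
      rw [hform]
      split_ifs with hk
      · exact Ideal.zero_mem _
      · exact Ideal.mul_mem_left _ _ (Ideal.subset_span ⟨k, hk, rfl⟩)
    · rintro _ ⟨k, hk, rfl⟩
      have hk : k ≠ c := hk
      have := Ideal.mul_mem_left _ (C (v c)⁻¹)
        (Ideal.subset_span (Set.mem_image_of_mem e (Set.mem_range_self (f := pointForm v c) k)))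
      rwa [hform, if_neg hk, ← mul_assoc, ← C_mul, inv_mul_cancel₀ hc, C_1, one_mul] at this
  rw [← quotHF_span_X_image_compl_pow (K := K) c hi, ← hmap, ← Ideal.map_pow,
    ← quotHF_comap_algEquiv e _ _ (Ideal.map e _)]
  · congr 1
    exact (Ideal.comap_map_of_bijective e e.bijective).symm
  · intro j
    rw [heX]
    split_ifs
    · exact isHomogeneous_X _ _
    · exact (isHomogeneous_X _ _).add (isHomogeneous_C_mul_X _ _)
  · intro j
    rw [heX']
    split_ifs
    · exact isHomogeneous_X _ _
    · exact (isHomogeneous_X _ _).sub (isHomogeneous_C_mul_X _ _)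

end PointIdeal

section Partials

variable {K : Type*} [Field K] {n : ℕ}

theorem Derivation.apply_mem_pow {R A : Type*} [CommSemiring R] [CommRing A] [Algebra R A]
    (D : Derivation R A A) {I : Ideal A} {k : ℕ} {x : A} (hx : x ∈ I ^ (k + 1)) :
    D x ∈ I ^ k := by
  induction k generalizing x with
  | zero => simp
  | succ k ih =>
    rw [pow_succ] at hx
    induction hx using Submodule.mul_induction_on' with
    | mem_mul_mem a ha b hb =>
      rw [D.leibniz, smul_eq_mul, smul_eq_mul, mul_comm b, pow_succ]
      exact add_mem (Ideal.mul_mem_right _ _ (pow_succ I k ▸ ha)) (Ideal.mul_mem_mul (ih ha) hb)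
    | add a _ b _ ha hb => rw [map_add]; exact add_mem ha hb

theorem pderiv_mem_partialsIdeal {I : Ideal (MvPolynomial (Fin (n + 1)) K)}
    {F : MvPolynomial (Fin (n + 1)) K} (hF : F ∈ I) (j : Fin (n + 1)) :
    pderiv j F ∈ partialsIdeal I :=
  Ideal.subset_span ⟨F, hF, j, rfl⟩

theorem le_partialsIdeal (I : Ideal (MvPolynomial (Fin (n + 1)) K)) : I ≤ partialsIdeal I := by
  intro F hF
  have h1 := pderiv_mem_partialsIdeal (I.mul_mem_left (X 0) hF) 0
  have h2 := (partialsIdeal I).mul_mem_left (X 0) (pderiv_mem_partialsIdeal hF 0)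
  have := sub_mem h1 h2
  rw [(pderiv (0 : Fin (n + 1))).leibniz, pderiv_X_self, smul_eq_mul, smul_eq_mul, mul_one] at this
  simpa using this

theorem partialsIdeal_mono {I J : Ideal (MvPolynomial (Fin (n + 1)) K)} (h : I ≤ J) :
    partialsIdeal I ≤ partialsIdeal J := by
  refine Ideal.span_mono ?_
  rintro _ ⟨F, hF, j, rfl⟩
  exact ⟨F, h hF, j, rfl⟩

theorem partialsIdeal_pow_succ_le (I : Ideal (MvPolynomial (Fin (n + 1)) K)) (k : ℕ) :
    partialsIdeal (I ^ (k + 1)) ≤ I ^ k := by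
  refine Ideal.span_le.mpr ?_
  rintro _ ⟨F, hF, j, rfl⟩
  exact (pderiv j).apply_mem_pow hF

/-- If an ideal `B` multiplies `I` into `J`, then its square multiplies `partialsIdeal I` into
`partialsIdeal J`. -/
theorem mul_mul_partialsIdeal_le {B I J : Ideal (MvPolynomial (Fin (n + 1)) K)} (h : B * I ≤ J) :
    B * (B * partialsIdeal I) ≤ partialsIdeal J := by
  refine Ideal.mul_le.mpr fun a ha x hx ↦ ?_
  induction hx using Submodule.mul_induction_on' with
  | mem_mul_mem b hb g hg =>
    induction hg using Submodule.span_induction with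
    | mem g hg =>
      obtain ⟨F, hF, j, rfl⟩ := hg
      have h1 := Ideal.mul_mem_left _ a
        (pderiv_mem_partialsIdeal (h (Ideal.mul_mem_mul hb hF)) j)
      have h2 := Ideal.mul_mem_right (pderiv j b) _
        (le_partialsIdeal J (h (Ideal.mul_mem_mul ha hF)))
      convert sub_mem h1 h2 using 1
      rw [Derivation.leibniz, smul_eq_mul, smul_eq_mul]
      ring
    | zero => simp
    | add x y _ _ hx hy => rw [mul_add, mul_add]; exact add_mem hx hy
    | smul r x _ hx =>
      convert Ideal.mul_mem_left _ r hx using 1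
      rw [smul_eq_mul]
      ring
  | add x _ y _ hx hy => rw [mul_add]; exact add_mem hx hy

theorem euler_sub_mem_pow {v : Fin (n + 1) → K} {c : Fin (n + 1)} (hc : v c ≠ 0) {k : ℕ}
    {F : MvPolynomial (Fin (n + 1)) K} (hF : F ∈ (pointIdeal v) ^ k) :
    ∑ i, pointForm v c i * pderiv i F - C (k * v c) * F ∈ (pointIdeal v) ^ (k + 1) := by
  let E : Derivation K (MvPolynomial (Fin (n + 1)) K) (MvPolynomial (Fin (n + 1)) K) :=
    ∑ i, pointForm v c i • pderiv i
  have hE (F) : E F = ∑ i, pointForm v c i * pderiv i F := by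
    have := congrFun (map_sum (Derivation.coeFnAddMonoidHom (R := K)
      (A := MvPolynomial (Fin (n + 1)) K) (M := MvPolynomial (Fin (n + 1)) K))
      (fun i ↦ pointForm v c i • pderiv i) Finset.univ) F
    exact this.trans (by rw [Finset.sum_apply]; rfl)
  rw [← hE]
  have hE1 (F) : E F ∈ pointIdeal v := by
    rw [hE]
    exact Ideal.sum_mem _ fun i _ ↦ Ideal.mul_mem_right _ _ (pointForm_mem v c i)
  have hEform (j) : E (pointForm v c j) = C (v c) * pointForm v c j := by
    rw [hE]
    have hp (i) : pderiv i (pointForm v c j) =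
        C (v c) * (if j = i then 1 else 0) - C (v j) * (if c = i then 1 else 0) := by
      simp [pointForm, pderiv_X, Pi.single_apply]
    simp only [hp, mul_sub, Finset.sum_sub_distrib, mul_ite, mul_one, mul_zero,
      Finset.sum_ite_eq, Finset.mem_univ, if_true, pointForm_self, zero_mul, sub_zero]
    ring
  have hE2 (F) (hF : F ∈ pointIdeal v) : E F - C (v c) * F ∈ pointIdeal v ^ 2 := by
    have hF' := hF
    rw [pointIdeal_eq_span hc] at hF'
    induction hF' using Submodule.span_induction with
    | mem x hx => obtain ⟨j, rfl⟩ := hx; rw [hEform, sub_self]; exact zero_mem _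
    | zero => simp
    | add x y hx hy h1 h2 =>
      rw [← Ideal.span, ← pointIdeal_eq_span hc] at hx hy
      convert add_mem (h1 hx) (h2 hy) using 1
      rw [map_add]; ring
    | smul a x hx h1 =>
      rw [← Ideal.span, ← pointIdeal_eq_span hc] at hx
      convert add_mem (Ideal.mul_mem_left _ a (h1 hx))
        (pow_two (pointIdeal v) ▸ Ideal.mul_mem_mul hx (hE1 a)) using 1
      rw [smul_eq_mul, E.leibniz, smul_eq_mul, smul_eq_mul]; ring
  induction k generalizing F with
  | zero => simpa using hE1 F
  | succ k ih =>
    rw [pow_succ] at hF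
    induction hF using Submodule.mul_induction_on' with
    | mem_mul_mem a ha b hb =>
      have h1 := Ideal.mul_mem_mul ha (hE2 b hb)
      have h2 := Ideal.mul_mem_mul (ih ha) hb
      rw [← pow_add] at h1
      rw [← pow_succ] at h2
      convert add_mem h1 h2 using 1
      rw [E.leibniz, smul_eq_mul, smul_eq_mul]
      simp only [Nat.cast_add, Nat.cast_one, add_mul, one_mul, C_add]
      ring
    | add a _ b _ ha hb =>
      convert add_mem ha hb using 1
      rw [map_add]; ring

theorem pointIdeal_pow_le_partialsIdeal [CharZero K] (hn : n ≠ 0) {v : Fin (n + 1) → K}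
    (hv : v ≠ 0) (k : ℕ) : (pointIdeal v) ^ k ≤ partialsIdeal ((pointIdeal v) ^ (k + 1)) := by
  obtain ⟨c, hc⟩ := Function.ne_iff.mp hv
  simp only [Pi.zero_apply] at hc
  intro F hF
  have h1 : ∑ i, pderiv i (pointForm v c i * F) ∈ partialsIdeal ((pointIdeal v) ^ (k + 1)) :=
    Ideal.sum_mem _ fun i _ ↦ pderiv_mem_partialsIdeal
      (pow_succ' (pointIdeal v) k ▸ Ideal.mul_mem_mul (pointForm_mem v c i) hF) i
  have h2 := le_partialsIdeal _ (euler_sub_mem_pow hc hF)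
  have h3 := sub_mem h1 h2
  have hform (i) : pderiv i (pointForm v c i) = C (v c) - if c = i then C (v c) else 0 := by
    split_ifs with h
    · subst h; simp [pointForm_self]
    · simp [pointForm, pderiv_X_of_ne h]
  have h4 : ∑ i, pderiv i (pointForm v c i * F) -
      (∑ i, pointForm v c i * pderiv i F - C (k * v c) * F) = C ((n + k) * v c) * F := by
    simp only [Derivation.leibniz, smul_eq_mul, Finset.sum_add_distrib, ← Finset.mul_sum, hform,
      Finset.sum_sub_distrib, Finset.sum_ite_eq, Finset.mem_univ, if_true, Finset.sum_const,
      Finset.card_univ, Fintype.card_fin, nsmul_eq_mul, Nat.cast_add, Nat.cast_one, C_mul, C_add,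
      map_natCast]
    ring
  rw [h4] at h3
  have h5 : ((n : K) + k) * v c ≠ 0 := by
    refine mul_ne_zero ?_ hc
    exact_mod_cast (by omega : n + k ≠ 0)
  have := Ideal.mul_mem_left _ (C ((n + k) * v c)⁻¹) h3
  rwa [← mul_assoc, ← C_mul, inv_mul_cancel₀ h5, C_1, one_mul] at this

end Partials

section FatPoints

variable {K : Type*} [Field K] {n : ℕ}

theorem Ideal.IsPrime.exists_le_of_iInf_pow_le {R ι : Type*} [CommSemiring R] [Finite ι]
    {q : Ideal R} (hq : q.IsPrime) (P : ι → Ideal R) (a : ι → ℕ) (h : ⨅ k, P k ^ a k ≤ q) :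
    ∃ k, P k ≤ q := by
  have := Fintype.ofFinite ι
  rw [← Finset.inf_univ_eq_iInf, hq.inf_le'] at h
  obtain ⟨k, -, hk⟩ := h
  exact ⟨k, hq.le_of_pow_le hk⟩

theorem MvPolynomial.IsHomogeneous.mem_idealOfVars_pow {σ R : Type*} [CommSemiring R]
    {F : MvPolynomial σ R} {i N : ℕ} (hF : F.IsHomogeneous i) (hi : N ≤ i) :
    F ∈ idealOfVars σ R ^ N := by
  rw [mem_pow_idealOfVars_iff']
  intro x hx
  exact hF.coeff_eq_zero (by omega)

theorem exists_idealOfVars_pow_le_sup_iInf {s : ℕ} (v : Fin s → (Fin (n + 1) → K))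
    (hv0 : ∀ j, v j ≠ 0) (hdist : ∀ i j, i ≠ j → ∀ c : K, v i ≠ c • v j) (a : Fin s → ℕ)
    (j : Fin s) :
    ∃ N, idealOfVars (Fin (n + 1)) K ^ N ≤
      pointIdeal (v j) ^ a j ⊔ ⨅ k : {k // k ≠ j}, pointIdeal (v k) ^ a k := by
  refine Ideal.exists_pow_le_of_le_radical_of_fg ?_ (idealOfVars_fg _ _)
  rw [Ideal.radical_eq_sInf]
  refine le_sInf ?_
  rintro q ⟨hle, hq⟩
  have h1 := hq.le_of_pow_le (le_sup_left.trans hle)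
  obtain ⟨k, hk⟩ := hq.exists_le_of_iInf_pow_le (fun k : {k // k ≠ j} ↦ pointIdeal (v k)) _
    (le_sup_right.trans hle)
  exact (idealOfVars_le_sup_pointIdeal (hv0 j) (hdist k j k.2)).trans (sup_le h1 hk)

theorem exists_idealOfVars_pow_le_iSup {s : ℕ} (hs : 0 < s) (v : Fin s → (Fin (n + 1) → K))
    (hv0 : ∀ j, v j ≠ 0) (hdist : ∀ i j, i ≠ j → ∀ c : K, v i ≠ c • v j) (a : Fin s → ℕ) :
    ∃ N, idealOfVars (Fin (n + 1)) K ^ N ≤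
      ⨆ j, (⨅ k : {k // k ≠ j}, pointIdeal (v k.1) ^ a k.1) *
        (⨅ k : {k // k ≠ j}, pointIdeal (v k.1) ^ a k.1) := by
  refine Ideal.exists_pow_le_of_le_radical_of_fg ?_ (idealOfVars_fg _ _)
  rw [Ideal.radical_eq_sInf]
  refine le_sInf ?_
  rintro q ⟨hle, hq⟩
  have h1 (j : Fin s) : ∃ k, k ≠ j ∧ pointIdeal (v k) ≤ q := by
    obtain ⟨k, hk⟩ := hq.exists_le_of_iInf_pow_le (fun k : {k // k ≠ j} ↦ pointIdeal (v k)) _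
      ((hq.mul_le.mp ((le_iSup _ j).trans hle)).elim id id)
    exact ⟨k, k.2, hk⟩
  obtain ⟨k, -, hk⟩ := h1 ⟨0, hs⟩
  obtain ⟨l, hlk, hl⟩ := h1 k
  exact (idealOfVars_le_sup_pointIdeal (hv0 k) (hdist l k hlk)).trans (sup_le hk hl)

theorem exists_mem_of_idealOfVars_pow_mul_le {I J : Ideal (MvPolynomial (Fin (n + 1)) K)} {N : ℕ}
    (h : idealOfVars (Fin (n + 1)) K ^ N * I ≤ J) :
    ∃ i₀, ∀ i ≥ i₀, ∀ F : MvPolynomial (Fin (n + 1)) K, F.IsHomogeneous i → F ∈ I → F ∈ J := by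
  obtain ⟨k, hk⟩ := Ideal.exists_pow_inf_eq_pow_smul (idealOfVars (Fin (n + 1)) K) I
  refine ⟨k + N, fun i hi F hF hFI ↦ h ?_⟩
  have h1 : F ∈ idealOfVars (Fin (n + 1)) K ^ (k + N) • (⊤ : Ideal _) ⊓ I := by
    rw [smul_eq_mul, Ideal.mul_top]
    exact ⟨hF.mem_idealOfVars_pow hi, hFI⟩
  rw [hk _ (by omega), Nat.add_sub_cancel_left] at h1
  exact Ideal.mul_mono_right inf_le_right h1

theorem quotHF_pointIdeal_pow_pred (hn : n ≠ 0) {v : Fin (n + 1) → K} (hv : v ≠ 0) {m i : ℕ}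
    (hm : 1 ≤ m) (hi : m ≤ i) :
    quotHF (pointIdeal v ^ (m - 1)) i = (m + n - 2).choose n := by
  obtain rfl | ⟨k, rfl⟩ : m = 1 ∨ ∃ k, m = k + 2 := by
    rcases m with _ | _ | k
    · omega
    · exact Or.inl rfl
    · exact Or.inr ⟨k, rfl⟩
  · rw [Nat.choose_eq_zero_of_lt (by omega), Nat.sub_self, pow_zero, Ideal.one_eq_top, quotHF,
      Submodule.restrictScalars_top, Submodule.comap_top]
    exact Module.finrank_zero_of_subsingleton
  · rw [show k + 2 - 1 = k + 1 by omega, quotHF_pointIdeal_pow hv (by omega)]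
    congr 1
    omega

theorem exists_mem_partialsIdeal_iff [CharZero K] (hn : n ≠ 0) {s : ℕ} (hs : 0 < s)
    (v : Fin s → (Fin (n + 1) → K)) (hv0 : ∀ j, v j ≠ 0)
    (hdist : ∀ i j, i ≠ j → ∀ c : K, v i ≠ c • v j) (m : Fin s → ℕ) (hm : ∀ j, 1 ≤ m j) :
    ∃ i₀, ∀ i ≥ i₀, ∀ F : MvPolynomial (Fin (n + 1)) K, F.IsHomogeneous i →
      (F ∈ partialsIdeal (⨅ j, pointIdeal (v j) ^ m j) ↔
        ∀ j, F ∈ pointIdeal (v j) ^ (m j - 1)) := by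
  obtain ⟨N, hN⟩ := exists_idealOfVars_pow_le_iSup hs v hv0 hdist m
  have h : idealOfVars (Fin (n + 1)) K ^ N * ⨅ j, pointIdeal (v j) ^ (m j - 1) ≤
      partialsIdeal (⨅ j, pointIdeal (v j) ^ m j) := by
    refine (Ideal.mul_mono_left hN).trans ?_
    rw [Ideal.iSup_mul]
    refine iSup_le fun j ↦ ?_
    rw [mul_assoc]
    refine le_trans ?_ (mul_mul_partialsIdeal_le (I := pointIdeal (v j) ^ m j)
      (B := ⨅ k : {k // k ≠ j}, pointIdeal (v k.1) ^ m k.1) (le_iInf fun k ↦ ?_))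
    · refine Ideal.mul_mono_right (Ideal.mul_mono_right ((iInf_le _ j).trans ?_))
      have := pointIdeal_pow_le_partialsIdeal hn (hv0 j) (m j - 1)
      rwa [Nat.sub_add_cancel (hm j)] at this
    · by_cases hk : k = j
      · subst hk
        exact Ideal.mul_le_right
      · exact Ideal.mul_le_left.trans
          (iInf_le (fun k : {k // k ≠ j} ↦ pointIdeal (v k.1) ^ m k.1) ⟨k, hk⟩)
  obtain ⟨i₀, hi₀⟩ := exists_mem_of_idealOfVars_pow_mul_le h
  refine ⟨i₀, fun i hi F hF ↦ ⟨fun hFJ j ↦ ?_, fun hFQ ↦ hi₀ i hi F hF (Ideal.mem_iInf.mpr hFQ)⟩⟩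
  refine partialsIdeal_pow_succ_le _ _ (partialsIdeal_mono ?_ hFJ)
  rw [Nat.sub_add_cancel (hm j)]
  exact iInf_le _ j

theorem pointIdeal_eq_bot {v : Fin 1 → K} (hv : v ≠ 0) : pointIdeal v = ⊥ := by
  have hv' : v 0 ≠ 0 := fun h ↦ hv (funext fun j ↦ by rw [Fin.fin_one_eq_zero j, h]; rfl)
  rw [pointIdeal_eq_span hv', Ideal.span_eq_bot]
  rintro _ ⟨j, rfl⟩
  rw [Fin.fin_one_eq_zero j, pointForm_self]

theorem partialsIdeal_bot : partialsIdeal (⊥ : Ideal (MvPolynomial (Fin (n + 1)) K)) = ⊥ := by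
  refine Ideal.span_eq_bot.mpr ?_
  rintro _ ⟨F, hF, j, rfl⟩
  rw [Ideal.mem_bot.mp hF, map_zero]

end FatPoints

/-- Let `W = m_1 P_1 + ⋯ + m_s P_s` be a fat point scheme in `ℙ^n` over a
field of characteristic zero and let `Y` be its slimming. Then the Hilbert polynomial of
`Ω^{n+1}_{R_W/K}` is the constant `Σ_j C(m_j + n - 2, n) = deg Y`. Via the graded
isomorphism `Ω^{n+1}_{R_W/K} ≅ (S/∂I_W)(-n-1)`, this says that the Hilbert function of
`S/∂I_W` takes this value in all sufficiently large degrees. -/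
theorem hilbertPolynomial_kaehler_top_forms {K : Type*} [Field K] [CharZero K]
    (n s : ℕ) (hs : 0 < s)
    (v : Fin s → (Fin (n + 1) → K))
    (hv0 : ∀ j, v j ≠ 0)
    (hdist : ∀ i j, i ≠ j → ∀ c : K, v i ≠ c • v j)
    (m : Fin s → ℕ) (hm : ∀ j, 1 ≤ m j) :
    ∃ i₀ : ℕ, ∀ i ≥ i₀,
      quotHF (partialsIdeal (⨅ j, (pointIdeal (v j)) ^ (m j))) i =
        ∑ j : Fin s, (m j + n - 2).choose n := by
  rcases Nat.eq_zero_or_pos n with rfl | hn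
  · have hs1 : s = 1 := by
      by_contra hne
      have h0 : v ⟨1, by omega⟩ 0 ≠ 0 := fun h ↦
        hv0 _ (funext fun j ↦ by rw [Fin.fin_one_eq_zero j, h]; rfl)
      refine hdist ⟨0, hs⟩ ⟨1, by omega⟩ (by simp) (v ⟨0, hs⟩ 0 / v ⟨1, by omega⟩ 0)
        (funext fun j ↦ ?_)
      rw [Fin.fin_one_eq_zero j, Pi.smul_apply, smul_eq_mul, div_mul_cancel₀ _ h0]
    subst hs1
    refine ⟨0, fun i _ ↦ ?_⟩
    have hI : ⨅ j, pointIdeal (v j) ^ m j = ⊥ := by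
      rw [eq_bot_iff, ← pointIdeal_eq_bot (hv0 0)]
      exact (iInf_le _ 0).trans (Ideal.pow_le_self (Nat.one_le_iff_ne_zero.mp (hm 0)))
    have key := quotHF_pointIdeal_pow (hv0 0) (Nat.zero_le i)
    simp only [zero_add, pow_one] at key
    rw [hI, partialsIdeal_bot, ← pointIdeal_eq_bot (hv0 0), key]
    simp
  · obtain ⟨i₁, h₁⟩ := exists_mem_partialsIdeal_iff hn.ne' hs v hv0 hdist m hm
    choose N hN using exists_idealOfVars_pow_le_sup_iInf v hv0 hdist (fun j ↦ m j - 1)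
    refine ⟨i₁ + ∑ j, N j + ∑ j, m j, fun i hi ↦ ?_⟩
    have hNi (j) : N j ≤ i := by
      have := Finset.single_le_sum (fun k _ ↦ Nat.zero_le (N k)) (Finset.mem_univ j)
      omega
    have hmi (j) : m j ≤ i := by
      have := Finset.single_le_sum (fun k _ ↦ Nat.zero_le (m k)) (Finset.mem_univ j)
      omega
    rw [quotHF_eq_sum (fun j ↦ pointIdeal (v j) ^ (m j - 1)) _ i
      (fun j F hF ↦ homogeneousComponent_mem_pointIdeal_pow hF i) (h₁ i (by omega))
      (fun F hF j ↦ hN j (hF.mem_idealOfVars_pow (hNi j)))]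
    exact Finset.sum_congr rfl fun j _ ↦ quotHF_pointIdeal_pow_pred hn.ne' (hv0 j) (hm j) (hmi j)
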